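/- The algebra Q^{U_n} of U_n-invariants in Q is generated as a ℂ-algebra by the five elements α₁, β₂, β₃, γ₁, γ₂; that is, Q^{U_n} = ℂ[α₁, β₂, β₃, γ₁, γ₂]. -/

import Mathlib

open MvPolynomial

noncomputable section

/-- The polynomial ring `𝒫 = ℂ[x_{ij} : 1 ≤ i ≤ n, 1 ≤ j ≤ 3]` in the entries of an
`n × 3` matrix of indeterminates. -/
abbrev P (n : ℕ) : Type := MvPolynomial (Fin n × Fin 3) ℂ

/-- The action of a matrix `g` on `𝒫`, given by `(g · f)(X) = f(gᵀ X)`;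
on variables it sends `x_{ij} ↦ ∑ s g_{si} x_{sj}`. -/
def matAct (n : ℕ) (g : Matrix (Fin n) (Fin n) ℂ) : P n →ₐ[ℂ] P n :=
  aeval fun p : Fin n × Fin 3 => ∑ s : Fin n, C (g s p.1) * X (s, p.2)

/-- The action of `σ ∈ S₃` permuting columns: `x_{ij} ↦ x_{iσ(j)}`. -/
def permAct (n : ℕ) (σ : Equiv.Perm (Fin 3)) : P n →ₐ[ℂ] P n :=
  aeval fun p : Fin n × Fin 3 => X (p.1, σ p.2)

/-- `g` is upper triangular with all diagonal entries equal to `1`, i.e. `g ∈ U_n`. -/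
def IsUpperUni (n : ℕ) (g : Matrix (Fin n) (Fin n) ℂ) : Prop :=
  (∀ i, g i i = 1) ∧ ∀ i j, j < i → g i j = 0

/-- `f` is `U_n`-invariant. -/
def UInv (n : ℕ) (f : P n) : Prop :=
  ∀ g : Matrix (Fin n) (Fin n) ℂ, IsUpperUni n g → matAct n g f = f

/-- `f ∈ Q_m` : each monomial of `f` has total degree `m` in the column-`j` variables,
for each `j`. -/
def InQm (n m : ℕ) (f : P n) : Prop :=
  ∀ d ∈ f.support, ∀ j : Fin 3, (∑ i : Fin n, d (i, j)) = m

/-- `f ∈ Q = ⊕ₘ Q_m` : each monomial of `f` has equal total degree in the three columns. -/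
def InQ (n : ℕ) (f : P n) : Prop :=
  ∀ d ∈ f.support, ∀ j : Fin 3, (∑ i : Fin n, d (i, j)) = ∑ i : Fin n, d (i, (0 : Fin 3))

/-- The variable `x_{(i+1)(j+1)}`, `i j : Fin 3` (0-indexed rows and columns). -/
def Xe (n : ℕ) (hn : 3 ≤ n) (i j : Fin 3) : P n := X (Fin.castLE hn i, j)

/-- `δ_{ij} = x_{1i} x_{2j} - x_{2i} x_{1j}` (0-indexed columns `i j : Fin 3`). -/
def del (n : ℕ) (hn : 3 ≤ n) (i j : Fin 3) : P n :=
  Xe n hn 0 i * Xe n hn 1 j - Xe n hn 1 i * Xe n hn 0 j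

/-- `α₁ = x₁₁ x₁₂ x₁₃`. -/
def alpha1 (n : ℕ) (hn : 3 ≤ n) : P n := Xe n hn 0 0 * Xe n hn 0 1 * Xe n hn 0 2

/-- `β₂ = x₁₂ δ₁₃`. -/
def beta2 (n : ℕ) (hn : 3 ≤ n) : P n := Xe n hn 0 1 * del n hn 0 2

/-- `β₃ = x₁₃ δ₁₂`. -/
def beta3 (n : ℕ) (hn : 3 ≤ n) : P n := Xe n hn 0 2 * del n hn 0 1

/-- `γ₁ = det (x_{ij})_{1 ≤ i,j ≤ 3}`. -/
def gamma1 (n : ℕ) (hn : 3 ≤ n) : P n := Matrix.det (Matrix.of fun i j : Fin 3 => Xe n hn i j)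

/-- `γ₂ = δ₁₂ δ₁₃ δ₂₃`. -/
def gamma2 (n : ℕ) (hn : 3 ≤ n) : P n := del n hn 0 1 * del n hn 0 2 * del n hn 1 2

/-- `α₂ = β₂² + β₃² − β₂ β₃`. -/
def alpha2 (n : ℕ) (hn : 3 ≤ n) : P n := beta2 n hn ^ 2 + beta3 n hn ^ 2 - beta2 n hn * beta3 n hn

/-- `α₃ = 2(β₂³ + β₃³) − 3(β₂² β₃ + β₂ β₃²)`. -/
def alpha3 (n : ℕ) (hn : 3 ≤ n) : P n :=
  2 * (beta2 n hn ^ 3 + beta3 n hn ^ 3) -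
    3 * (beta2 n hn ^ 2 * beta3 n hn + beta2 n hn * beta3 n hn ^ 2)

/-! ### Weight components of scaling-stable subspaces -/

theorem eval_mul_of_support {σ : Type*} [Fintype σ] (f : MvPolynomial σ ℂ) (a x : σ → ℂ) (κ : ℂ)
    (h : ∀ d ∈ f.support, ∏ p, a p ^ d p = κ) :
    eval (fun p => a p * x p) f = κ * eval x f := by
  rw [eval_eq', eval_eq', Finset.mul_sum]
  refine Finset.sum_congr rfl fun d hd => ?_
  rw [← h d hd]
  simp only [mul_pow, Finset.prod_mul_distrib]
  ring

theorem support_weightedHomogeneousComponent_subset {σ : Type*} (w : σ → ℕ) (c : ℕ)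
    (f : MvPolynomial σ ℂ) : (weightedHomogeneousComponent w c f).support ⊆ f.support := by
  classical
  intro d hd
  rw [mem_support_iff, coeff_weightedHomogeneousComponent] at hd
  rw [mem_support_iff]
  intro h
  simp [h] at hd

theorem weight_eq_of_mem_support {σ : Type*} (w : σ → ℕ) (c : ℕ) (f : MvPolynomial σ ℂ)
    (d : σ →₀ ℕ) (hd : d ∈ (weightedHomogeneousComponent w c f).support) :
    Finsupp.weight w d = c :=
  weightedHomogeneousComponent_isWeightedHomogeneous c f (mem_support_iff.mp hd)

theorem exists_sum_weightedHomogeneousComponent {σ : Type*} (w : σ → ℕ) (f : MvPolynomial σ ℂ) :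
    ∃ s : Finset ℕ, ∑ c ∈ s, weightedHomogeneousComponent w c f = f :=
  ⟨_, (finsum_eq_sum _ (weightedHomogeneousComponent_finsupp f)).symm.trans
    (sum_weightedHomogeneousComponent w f)⟩

/-- A subspace stable under the one-parameter torus attached to the weights `w` contains the
`w`-homogeneous components of its elements. -/
theorem weightedHomogeneousComponent_mem {σ : Type*} [Fintype σ] (w : σ → ℕ)
    (V : Submodule ℂ (MvPolynomial σ ℂ))
    (hV : ∀ t : ℂ, t ≠ 0 → ∀ f ∈ V, aeval (fun p => C (t ^ w p) * X p) f ∈ V)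
    (f : MvPolynomial σ ℂ) (hf : f ∈ V) (c : ℕ) : weightedHomogeneousComponent w c f ∈ V := by
  by_contra hc
  obtain ⟨l, hl, hVl⟩ := V.exists_le_ker_of_notMem hc
  obtain ⟨s, hs⟩ := exists_sum_weightedHomogeneousComponent w f
  have hscale : ∀ t : ℂ, aeval (fun p => C (t ^ w p) * X p) f =
      ∑ e ∈ s, t ^ e • weightedHomogeneousComponent w e f := by
    intro t
    conv_lhs => rw [← hs]
    rw [map_sum]
    refine Finset.sum_congr rfl fun e _ => MvPolynomial.funext fun x => ?_
    have : eval x (aeval (fun p => C (t ^ w p) * X p) (weightedHomogeneousComponent w e f) :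
        MvPolynomial σ ℂ) = eval (fun p => t ^ w p * x p) (weightedHomogeneousComponent w e f) := by
      rw [← coe_aeval_eq_eval, ← coe_aeval_eq_eval]
      change (aeval x) (aeval _ _) = aeval _ _
      rw [← AlgHom.comp_apply, comp_aeval]
      simp
    rw [this, smul_eval]
    refine eval_mul_of_support _ _ _ _ fun d hd => ?_
    rw [← weight_eq_of_mem_support w e f d hd, Finsupp.weight_apply,
      Finsupp.sum_fintype _ _ (by simp), ← Finset.prod_pow_eq_pow_sum]
    refine Finset.prod_congr rfl fun p _ => ?_
    rw [← pow_mul, smul_eq_mul, mul_comm]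
  let q : Polynomial ℂ :=
    ∑ e ∈ s, Polynomial.monomial e (l (weightedHomogeneousComponent w e f))
  have hq : ∀ t : ℂ, t ≠ 0 → q.eval t = 0 := by
    intro t ht
    have h := hVl (hV t ht f hf)
    rw [hscale, LinearMap.mem_ker, map_sum] at h
    simp only [map_smul, smul_eq_mul] at h
    rw [← h]
    simp [q, Polynomial.eval_finsetSum, mul_comm]
  have hq0 : q = 0 := by
    have : Polynomial.X * q = 0 := Polynomial.funext fun t => by
      by_cases ht : t = 0
      · simp [ht]
      · simp [hq t ht]
    simpa using this
  have hcoef : q.coeff c = if c ∈ s then l (weightedHomogeneousComponent w c f) else 0 := by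
    simp [q, Polynomial.coeff_monomial]
  rw [hq0, Polynomial.coeff_zero] at hcoef
  by_cases hcs : c ∈ s
  · rw [if_pos hcs] at hcoef
    exact hl hcoef.symm
  · apply hl
    have h0 : weightedHomogeneousComponent w c f = 0 := by
      refine weightedHomogeneousComponent_eq_zero' _ _ fun d hd hdc => ?_
      classical
      rw [← hs] at hd
      obtain ⟨e, he, hde⟩ := Finset.mem_biUnion.mp (support_sum hd)
      rw [weight_eq_of_mem_support w e f d hde] at hdc
      exact hcs (hdc ▸ he)
    rw [h0, map_zero]

/-! ### Invariance in terms of evaluations -/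

theorem eval_matAct (n : ℕ) (g : Matrix (Fin n) (Fin n) ℂ) (f : P n) (x : Fin n × Fin 3 → ℂ) :
    eval x (matAct n g f) = eval (fun p => ∑ s, g s p.1 * x (s, p.2)) f := by
  rw [matAct, ← coe_aeval_eq_eval, ← coe_aeval_eq_eval]
  change (aeval x) (aeval _ _) = aeval _ _
  rw [← AlgHom.comp_apply, comp_aeval]
  simp

theorem eval_scale {σ : Type*} (a : σ → ℂ) (f : MvPolynomial σ ℂ) (x : σ → ℂ) :
    eval x (aeval (fun p => C (a p) * X p) f : MvPolynomial σ ℂ) = eval (fun p => a p * x p) f := by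
  rw [← coe_aeval_eq_eval, ← coe_aeval_eq_eval]
  change (aeval x) (aeval _ _) = aeval _ _
  rw [← AlgHom.comp_apply, comp_aeval]
  simp

theorem uInv_iff_eval (n : ℕ) (f : P n) :
    UInv n f ↔ ∀ g : Matrix (Fin n) (Fin n) ℂ, IsUpperUni n g → ∀ x : Fin n × Fin 3 → ℂ,
      eval (fun p => ∑ s, g s p.1 * x (s, p.2)) f = eval x f := by
  refine forall₂_congr fun g _ => ⟨fun h x => ?_, fun h => MvPolynomial.funext fun x => ?_⟩
  · rw [← eval_matAct, h]
  · rw [eval_matAct, h]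

/-- The algebra of `U_n`-invariants. -/
def invariants (n : ℕ) : Subalgebra ℂ (P n) where
  carrier := {f | UInv n f}
  mul_mem' hf hg u hu := by rw [map_mul, hf u hu, hg u hu]
  add_mem' hf hg u hu := by rw [map_add, hf u hu, hg u hu]
  algebraMap_mem' c u _ := AlgHom.commutes _ c

theorem uInv_scale (n : ℕ) (u : Fin n → ℕ) (v : Fin 3 → ℕ) (t : ℂ) (ht : t ≠ 0) (f : P n)
    (hf : UInv n f) : UInv n (aeval (fun p => C (t ^ (u p.1 + v p.2)) * X p) f) := by
  rw [uInv_iff_eval] at hf ⊢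
  intro g hg x
  rw [eval_scale, eval_scale]
  have hg' : IsUpperUni n (Matrix.of fun s i => t ^ u i * g s i / t ^ u s) := by
    refine ⟨fun i => ?_, fun i j hij => ?_⟩
    · simp [hg.1 i, ht]
    · simp [hg.2 i j hij]
  rw [← hf _ hg' fun p => t ^ (u p.1 + v p.2) * x p]
  congr 2
  ext p
  rw [Finset.mul_sum]
  refine Finset.sum_congr rfl fun s _ => ?_
  simp only [Matrix.of_apply, pow_add]
  field_simp

/-- Adding multiples of the first three rows to later rows does not change an invariant. -/
theorem UInv.eval_rowOps {n : ℕ} (hn : 3 ≤ n) {f : P n} (hf : UInv n f) (x : Fin n × Fin 3 → ℂ)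
    (c : Fin n → Fin 3 → ℂ) :
    eval (fun p => x p + ∑ k : Fin 3,
      if Fin.castLE hn k < p.1 then c p.1 k * x (Fin.castLE hn k, p.2) else 0) f = eval x f := by
  rw [uInv_iff_eval] at hf
  have hg : IsUpperUni n (Matrix.of fun s i => (if s = i then 1 else 0) +
      ∑ k : Fin 3, if s = Fin.castLE hn k then (if Fin.castLE hn k < i then c i k else 0) else 0) := by
    refine ⟨fun i => ?_, fun i j hij => ?_⟩
    · simp only [Matrix.of_apply, if_true, add_eq_left]
      refine Finset.sum_eq_zero fun k _ => ?_
      split_ifs with h1 h2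
      · exact absurd h1 h2.ne'
      · rfl
      · rfl
    · simp only [Matrix.of_apply, if_neg hij.ne', zero_add]
      refine Finset.sum_eq_zero fun k _ => ?_
      split_ifs with h1 h2
      · exact absurd (h1 ▸ h2) hij.not_gt
      · rfl
      · rfl
  rw [← hf _ hg x]
  congr 2
  ext p
  simp only [Matrix.of_apply, add_mul, Finset.sum_add_distrib, Finset.sum_mul]
  rw [Finset.sum_comm]
  simp

/-! ### Normal form of a generic matrix -/

/-- The `n × 3` matrix with given first three rows and zeros below. -/
def padRows (n : ℕ) {A : Type*} [Zero A] (R : Fin 3 → Fin 3 → A) (p : Fin n × Fin 3) : A :=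
  if h : p.1.val < 3 then R ⟨p.1.val, h⟩ p.2 else 0

theorem padRows_castLE (n : ℕ) (hn : 3 ≤ n) {A : Type*} [Zero A] (R : Fin 3 → Fin 3 → A)
    (i j : Fin 3) : padRows n R (Fin.castLE hn i, j) = R i j := by
  simp [padRows]

theorem eval_aeval_padRows {n : ℕ} {R : Fin 3 → Fin 3 → Polynomial ℂ} {r : ℂ}
    (S : Fin 3 → Fin 3 → ℂ) (h : ∀ i j, (R i j).eval r = S i j) (f : P n) :
    (aeval (padRows n R) f).eval r = eval (padRows n S) f := by
  rw [← Polynomial.coe_aeval_eq_eval, ← coe_aeval_eq_eval]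
  change (Polynomial.aeval r) (aeval _ _) = aeval _ _
  rw [← AlgHom.comp_apply, comp_aeval]
  congr 2
  ext p
  simp only [padRows]
  split_ifs <;> simp [h]

theorem exists_rowOps {n : ℕ} (hn : 3 ≤ n) (x : Fin n × Fin 3 → ℂ)
    (h1 : eval x (Xe n hn 0 0) ≠ 0) (h2 : eval x (del n hn 0 1) ≠ 0)
    (h3 : eval x (gamma1 n hn) ≠ 0) (i : Fin n) :
    ∃ c : Fin 3 → ℂ, ∀ j, x (i, j) + (∑ k : Fin 3,
      if Fin.castLE hn k < i then c k * x (Fin.castLE hn k, j) else 0) =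
      padRows n (![fun j => eval x (Xe n hn 0 j),
        ![0, eval x (del n hn 0 1) / eval x (Xe n hn 0 0),
          eval x (del n hn 0 2) / eval x (Xe n hn 0 0)],
        ![0, 0, eval x (gamma1 n hn) / eval x (del n hn 0 1)]]) (i, j) := by
  by_cases hi : i.val < 3
  · obtain ⟨i, rfl⟩ : ∃ k : Fin 3, i = Fin.castLE hn k := ⟨⟨i.val, hi⟩, rfl⟩
    simp only [padRows_castLE]
    simp only [del, Xe, gamma1, Matrix.det_fin_three, Matrix.of_apply, map_sub, map_mul, map_add,
      eval_X, Fin.castLE_lt_castLE_iff] at h1 h2 h3 ⊢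
    fin_cases i
    · exact ⟨0, fun j => by simp⟩
    · refine ⟨![-x (Fin.castLE hn 1, 0) / x (Fin.castLE hn 0, 0), 0, 0], fun j => ?_⟩
      fin_cases j <;> simp <;> field_simp <;> ring
    · obtain ⟨b, hb⟩ : ∃ b, b * (x (Fin.castLE hn 0, 0) * x (Fin.castLE hn 1, 1) -
          x (Fin.castLE hn 1, 0) * x (Fin.castLE hn 0, 1)) =
          -(x (Fin.castLE hn 0, 0) * x (Fin.castLE hn 2, 1) -
            x (Fin.castLE hn 0, 1) * x (Fin.castLE hn 2, 0)) :=
        ⟨_, div_mul_cancel₀ _ h2⟩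
      refine ⟨![-(x (Fin.castLE hn 2, 0) + b * x (Fin.castLE hn 1, 0)) /
        x (Fin.castLE hn 0, 0), b, 0], fun j => ?_⟩
      fin_cases j <;> simp [Fin.sum_univ_three]
      · field_simp
        ring
      · field_simp
        linear_combination hb
      · rw [eq_div_iff h2]
        field_simp
        linear_combination (x (Fin.castLE hn 0, 0) * x (Fin.castLE hn 1, 2) -
          x (Fin.castLE hn 1, 0) * x (Fin.castLE hn 0, 2)) * hb
  · have hlt : ∀ k : Fin 3, Fin.castLE hn k < i := fun k => by
      rw [Fin.lt_def, Fin.val_castLE]; omega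
    let R : Matrix (Fin 3) (Fin 3) ℂ := Matrix.of fun k j => x (Fin.castLE hn k, j)
    have hR : IsUnit R.det := by
      rw [isUnit_iff_ne_zero]
      convert h3
      rw [gamma1, RingHom.map_det]
      congr 1
      ext k j
      simp [R, Xe]
    refine ⟨Matrix.vecMul (fun j => -x (i, j)) R⁻¹, fun j => ?_⟩
    have h := congrFun (Matrix.vecMul_vecMul (fun j => -x (i, j)) R⁻¹ R) j
    rw [Matrix.nonsing_inv_mul _ hR, Matrix.vecMul_one] at h
    simp only [hlt, if_true, padRows, dif_neg hi]
    simp only [Matrix.vecMul, dotProduct, R, Matrix.of_apply] at h ⊢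
    rw [h]
    ring

/-! ### Homogeneous invariants -/

/-- All columns have degree `m`, the second row has degree `D` and the third row degree `k`. -/
def HasDegrees (n : ℕ) (hn : 3 ≤ n) (m D k : ℕ) (f : P n) : Prop :=
  ∀ d ∈ f.support, (∀ j, ∑ i, d (i, j) = m) ∧ ∑ j, d (Fin.castLE hn 1, j) = D ∧
    ∑ j, d (Fin.castLE hn 2, j) = k

theorem HasDegrees.eval_scale {n : ℕ} {hn : 3 ≤ n} {m D k : ℕ} {f : P n}
    (hf : HasDegrees n hn m D k f) (x : Fin n × Fin 3 → ℂ) (v w : ℂ) (b : Fin 3 → ℂ) :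
    eval (fun p => ((if p.1 = Fin.castLE hn 1 then v else if p.1 = Fin.castLE hn 2 then w else 1)
      * b p.2) * x p) f = (b 0 * b 1 * b 2) ^ m * v ^ D * w ^ k * eval x f := by
  refine eval_mul_of_support f _ x _ fun d hd => ?_
  obtain ⟨h1, h2, h3⟩ := hf d hd
  obtain ⟨a, ha⟩ : ∃ a : Fin n → ℂ,
      a = fun i => if i = Fin.castLE hn 1 then v else if i = Fin.castLE hn 2 then w else 1 :=
    ⟨_, rfl⟩
  have hne : Fin.castLE hn 2 ≠ Fin.castLE hn 1 := by simp
  have hrows : ∏ p : Fin n × Fin 3, a p.1 ^ d p = v ^ D * w ^ k := by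
    rw [Fintype.prod_prod_type]
    simp only [Finset.prod_pow_eq_pow_sum]
    rw [← Finset.mul_prod_erase _ _ (Finset.mem_univ (Fin.castLE hn 1)),
      ← Finset.mul_prod_erase _ _ (Finset.mem_erase.mpr ⟨hne, Finset.mem_univ _⟩),
      Finset.prod_eq_one, h2, h3]
    · simp [ha]
    · intro i hi
      simp only [Finset.mem_erase] at hi
      simp [ha, hi.1, hi.2.1]
  have hcols : ∏ p : Fin n × Fin 3, b p.2 ^ d p = (b 0 * b 1 * b 2) ^ m := by
    rw [Fintype.prod_prod_type_right]
    simp only [Finset.prod_pow_eq_pow_sum, h1, Fin.prod_univ_three, mul_pow]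
  rw [mul_assoc, ← hrows, ← hcols, ha, mul_comm, ← Finset.prod_mul_distrib]
  simp only [mul_pow]

/-- The restriction of `f` to a line meeting the generic orbits of the unipotent group and the
torus. -/
def slice (n : ℕ) (f : P n) : Polynomial ℂ :=
  aeval (padRows n ![![1, 1, 1], ![0, 1, Polynomial.X], ![0, 0, 1]]) f

theorem eval_slice (n : ℕ) (f : P n) (t : ℂ) :
    (slice n f).eval t = eval (padRows n ![![1, 1, 1], ![0, 1, t], ![0, 0, 1]]) f := by
  refine eval_aeval_padRows _ (fun i j => ?_) f
  fin_cases i <;> fin_cases j <;> simp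

theorem UInv.eval_eq_slice {n : ℕ} {hn : 3 ≤ n} {m D k : ℕ} {f : P n} (hf : UInv n f)
    (hd : HasDegrees n hn m D k f) (x : Fin n × Fin 3 → ℂ)
    (h1 : eval x (alpha1 n hn) ≠ 0) (h2 : eval x (beta3 n hn) ≠ 0)
    (h3 : eval x (gamma1 n hn) ≠ 0) :
    eval x f = eval x (alpha1 n hn) ^ m * (eval x (beta3 n hn) / eval x (alpha1 n hn)) ^ D *
      (eval x (gamma1 n hn) / eval x (beta3 n hn)) ^ k *
      (slice n f).eval (eval x (beta2 n hn) / eval x (beta3 n hn)) := by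
  simp only [alpha1, beta3, map_mul, mul_ne_zero_iff] at h1 h2
  obtain ⟨⟨hx0, hx1⟩, hx2⟩ := h1
  obtain ⟨-, hdel⟩ := h2
  choose c hc using exists_rowOps hn x hx0 hdel h3
  rw [← hf.eval_rowOps hn x c, eval_slice]
  have hscale := fun y v w => hd.eval_scale y v w fun j => eval x (Xe n hn 0 j)
  rw [show eval x (Xe n hn 0 0) * eval x (Xe n hn 0 1) * eval x (Xe n hn 0 2) =
    eval x (alpha1 n hn) by simp [alpha1]] at hscale
  rw [← hscale]
  congr 2
  ext ⟨i, j⟩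
  simp only
  rw [hc]
  by_cases hi : i.val < 3
  · obtain ⟨i, rfl⟩ : ∃ k : Fin 3, i = Fin.castLE hn k := ⟨⟨i.val, hi⟩, rfl⟩
    simp only [padRows_castLE, Fin.castLE_inj]
    have e2 : eval x (beta2 n hn) = eval x (Xe n hn 0 1) * eval x (del n hn 0 2) := by
      simp [beta2]
    have e3 : eval x (beta3 n hn) = eval x (Xe n hn 0 2) * eval x (del n hn 0 1) := by
      simp [beta3]
    have e1 : eval x (alpha1 n hn) =
      eval x (Xe n hn 0 0) * eval x (Xe n hn 0 1) * eval x (Xe n hn 0 2) := by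
      simp [alpha1]
    rw [e1, e2, e3]
    fin_cases i <;> fin_cases j <;> simp <;> field_simp
  · simp [padRows, hi]

/-! ### Divisibility properties of the slice -/

theorem natDegree_add_le_of_eval_inv (p A : Polynomial ℂ) (hp : p ≠ 0) (m k : ℕ)
    (h : ∀ r : ℂ, r ≠ 0 → r ^ m * p.eval r⁻¹ = r ^ k * A.eval r) : p.natDegree + k ≤ m := by
  have hpoly : Polynomial.X ^ m * p.reverse = Polynomial.X ^ (p.natDegree + k) * A := by
    have : Polynomial.X * (Polynomial.X ^ m * p.reverse) =
        Polynomial.X * (Polynomial.X ^ (p.natDegree + k) * A) := Polynomial.funext fun r => by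
      by_cases hr : r = 0
      · simp [hr]
      have hrev : p.reverse.eval r = r ^ p.natDegree * p.eval r⁻¹ := by
        let := invertibleOfNonzero (inv_ne_zero hr)
        have := Polynomial.eval₂_reverse_mul_pow (RingHom.id ℂ) r⁻¹ p
        rw [invOf_eq_inv, inv_inv, Polynomial.eval₂_id, Polynomial.eval₂_id] at this
        rw [← this, mul_comm, mul_assoc, ← mul_pow, inv_mul_cancel₀ hr, one_pow, mul_one]
      simp only [Polynomial.eval_mul, Polynomial.eval_X, Polynomial.eval_pow, hrev]
      rw [pow_add]
      linear_combination r * r ^ p.natDegree * h r hr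
    exact mul_left_cancel₀ Polynomial.X_ne_zero this
  by_contra! hlt
  have hdvd : Polynomial.X ^ (m + 1) ∣ Polynomial.X ^ m * p.reverse := by
    rw [hpoly]
    exact (pow_dvd_pow _ hlt).mul_right _
  rw [pow_succ, mul_dvd_mul_iff_left (pow_ne_zero _ Polynomial.X_ne_zero),
    Polynomial.X_dvd_iff, Polynomial.coeff_zero_reverse] at hdvd
  exact hp (Polynomial.leadingCoeff_eq_zero.mp hdvd)

theorem X_pow_dvd_of_eval (p A : Polynomial ℂ) (m D : ℕ)
    (h : ∀ r : ℂ, r ≠ 0 → r ^ m * p.eval r = r ^ D * A.eval r) :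
    Polynomial.X ^ (D - m) ∣ p := by
  have hpoly : Polynomial.X ^ m * p = Polynomial.X ^ D * A := by
    have : Polynomial.X * (Polynomial.X ^ m * p) = Polynomial.X * (Polynomial.X ^ D * A) :=
      Polynomial.funext fun r => by
        by_cases hr : r = 0
        · simp [hr]
        · simp [h r hr]
    exact mul_left_cancel₀ Polynomial.X_ne_zero this
  rcases le_total D m with hDm | hDm
  · simp [Nat.sub_eq_zero_of_le hDm]
  · rw [← Nat.add_sub_cancel' hDm, pow_add, mul_assoc] at hpoly
    exact ⟨A, mul_left_cancel₀ (pow_ne_zero _ Polynomial.X_ne_zero) hpoly⟩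

section Slice

variable {n : ℕ} {hn : 3 ≤ n} {m D k : ℕ} {f : P n}

theorem eval_generators_padRows (R : Fin 3 → Fin 3 → ℂ) :
    eval (padRows n R) (alpha1 n hn) = R 0 0 * R 0 1 * R 0 2 ∧
    eval (padRows n R) (beta2 n hn) = R 0 1 * (R 0 0 * R 1 2 - R 1 0 * R 0 2) ∧
    eval (padRows n R) (beta3 n hn) = R 0 2 * (R 0 0 * R 1 1 - R 1 0 * R 0 1) ∧
    eval (padRows n R) (gamma1 n hn) = R 0 0 * R 1 1 * R 2 2 - R 0 0 * R 1 2 * R 2 1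
      - R 0 1 * R 1 0 * R 2 2 + R 0 1 * R 1 2 * R 2 0 + R 0 2 * R 1 0 * R 2 1
      - R 0 2 * R 1 1 * R 2 0 := by
  refine ⟨?_, ?_, ?_, ?_⟩ <;>
  simp [alpha1, beta2, beta3, gamma1, del, Xe, padRows_castLE, Matrix.det_fin_three]

theorem UInv.natDegree_slice_add_le_columns (hf : UInv n f) (hd : HasDegrees n hn m D k f)
    (hp : slice n f ≠ 0) : (slice n f).natDegree + k ≤ m := by
  refine natDegree_add_le_of_eval_inv _
    (aeval (padRows n ![![1, 1, Polynomial.X], ![0, 1, 1], ![0, 0, 1]]) f) hp m k fun r hr => ?_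
  rw [eval_aeval_padRows
    ![![1, 1, r], ![0, 1, 1], ![0, 0, 1]]
    (fun i j => by fin_cases i <;> fin_cases j <;> simp)]
  obtain ⟨h1, h2, h3, h4⟩ := eval_generators_padRows (n := n) (hn := hn)
    ![![1, 1, r], ![0, 1, 1], ![0, 0, 1]]
  simp at h1 h2 h3 h4
  rw [hf.eval_eq_slice hd _ (by rwa [h1]) (by rwa [h3]) (by simp [h4]), h1, h2, h3, h4]
  simp [hr]
  field_simp

theorem UInv.natDegree_slice_add_le_rows (hf : UInv n f) (hd : HasDegrees n hn m D k f)
    (hp : slice n f ≠ 0) : (slice n f).natDegree + k ≤ D := by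
  refine natDegree_add_le_of_eval_inv _
    (Polynomial.C ((-1) ^ k) *
      aeval (padRows n ![![1, 1, 1], ![0, Polynomial.X, 1], ![0, 1, 0]]) f) hp D k fun r hr => ?_
  rw [Polynomial.eval_mul, Polynomial.eval_C, eval_aeval_padRows
    ![![1, 1, 1], ![0, r, 1], ![0, 1, 0]]
    (fun i j => by fin_cases i <;> fin_cases j <;> simp)]
  obtain ⟨h1, h2, h3, h4⟩ := eval_generators_padRows (n := n) (hn := hn)
    ![![1, 1, 1], ![0, r, 1], ![0, 1, 0]]
  simp at h1 h2 h3 h4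
  rw [hf.eval_eq_slice hd _ (by simp [h1]) (by rwa [h3]) (by simp [h4]), h1, h2, h3, h4]
  have : ((-1 : ℂ) ^ k) * (-1) ^ k = 1 := by rw [← mul_pow]; simp
  simp [div_pow]
  field_simp
  linear_combination (-1 : ℂ) * (slice n f).eval (1 / r) * this

theorem UInv.X_pow_dvd_slice (hf : UInv n f) (hd : HasDegrees n hn m D k f) :
    Polynomial.X ^ (D - m) ∣ slice n f := by
  refine X_pow_dvd_of_eval _ (Polynomial.C ((-1) ^ k) *
    aeval (padRows n ![![1, Polynomial.X, 1], ![0, 1, 1], ![0, 1, 0]]) f) m D fun r hr => ?_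
  rw [Polynomial.eval_mul, Polynomial.eval_C, eval_aeval_padRows
    ![![1, r, 1], ![0, 1, 1], ![0, 1, 0]]
    (fun i j => by fin_cases i <;> fin_cases j <;> simp)]
  obtain ⟨h1, h2, h3, h4⟩ := eval_generators_padRows (n := n) (hn := hn)
    ![![1, r, 1], ![0, 1, 1], ![0, 1, 0]]
  simp at h1 h2 h3 h4
  rw [hf.eval_eq_slice hd _ (by simp [h1, hr]) (by simp [h3]) (by simp [h4]), h1, h2, h3, h4]
  have : ((-1 : ℂ) ^ k) * (-1) ^ k = 1 := by rw [← mul_pow]; simp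
  simp
  field_simp
  linear_combination (-1 : ℂ) * (slice n f).eval r * this

theorem UInv.X_sub_one_pow_dvd_slice (hf : UInv n f) (hd : HasDegrees n hn m D k f) :
    (Polynomial.X - 1) ^ (D - m) ∣ slice n f := by
  have h : Polynomial.X ^ (D - m) ∣ (slice n f).comp (Polynomial.X + 1) := by
    refine X_pow_dvd_of_eval _ (Polynomial.C ((-1) ^ m) *
      aeval (padRows n ![![-Polynomial.X, 1, 1], ![1, 0, 1], ![0, 0, 1]]) f) m D fun r hr => ?_
    rw [Polynomial.eval_mul, Polynomial.eval_C, eval_aeval_padRows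
      ![![-r, 1, 1], ![1, 0, 1], ![0, 0, 1]]
      (fun i j => by fin_cases i <;> fin_cases j <;> simp)]
    obtain ⟨h1, h2, h3, h4⟩ := eval_generators_padRows (n := n) (hn := hn)
      ![![-r, 1, 1], ![1, 0, 1], ![0, 0, 1]]
    simp at h1 h2 h3 h4
    rw [hf.eval_eq_slice hd _ (by simp [h1, hr]) (by simp [h3]) (by simp [h4]), h1, h2, h3, h4]
    have : ((-1 : ℂ) ^ m) * (-1) ^ m = 1 := by rw [← mul_pow]; simp
    have hr1 : (-r - 1) / -1 = r + 1 := by ring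
    rw [hr1, neg_pow r m]
    simp
    field_simp
    linear_combination (-1 : ℂ) * (slice n f).eval (r + 1) * this
  obtain ⟨q, hq⟩ := h
  refine ⟨q.comp (Polynomial.X - 1), ?_⟩
  have := congrArg (fun p : Polynomial ℂ => p.comp (Polynomial.X - 1)) hq
  simpa [Polynomial.comp_assoc] using this

theorem UInv.exists_slice_eq (hf : UInv n f) (hd : HasDegrees n hn m D k f) :
    ∃ q : Polynomial ℂ, slice n f = (Polynomial.X * (Polynomial.X - 1)) ^ (D - m) * q := by
  rw [mul_pow]
  refine IsCoprime.mul_dvd (IsCoprime.pow ⟨1, -1, ?_⟩) (hf.X_pow_dvd_slice hd)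
    (hf.X_sub_one_pow_dvd_slice hd)
  ring

end Slice

/-! ### Generators -/

/-- The algebra generated by the five basic invariants. -/
abbrev generated (n : ℕ) (hn : 3 ≤ n) : Subalgebra ℂ (P n) :=
  Algebra.adjoin ℂ {alpha1 n hn, beta2 n hn, beta3 n hn, gamma1 n hn, gamma2 n hn}

/-- The degree `N` homogenization of `q` evaluated at `β₂`, `β₃`. -/
def betaForm (n : ℕ) (hn : 3 ≤ n) (q : Polynomial ℂ) (N : ℕ) : P n :=
  ∑ i ∈ Finset.range (N + 1), C (q.coeff i) * beta2 n hn ^ i * beta3 n hn ^ (N - i)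

theorem betaForm_mem (n : ℕ) (hn : 3 ≤ n) (q : Polynomial ℂ) (N : ℕ) :
    betaForm n hn q N ∈ generated n hn := by
  refine sum_mem fun i _ => mul_mem (mul_mem (algebraMap_mem _ _) (pow_mem ?_ _)) (pow_mem ?_ _) <;>
  exact Algebra.subset_adjoin (by simp)

theorem eval_betaForm (n : ℕ) (hn : 3 ≤ n) (q : Polynomial ℂ) (N : ℕ) (hN : q.natDegree ≤ N)
    (x : Fin n × Fin 3 → ℂ) (hx : eval x (beta3 n hn) ≠ 0) :
    eval x (betaForm n hn q N) =
      eval x (beta3 n hn) ^ N * q.eval (eval x (beta2 n hn) / eval x (beta3 n hn)) := by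
  rw [betaForm, map_sum, Polynomial.eval_eq_sum_range' (Nat.lt_succ_of_le hN), Finset.mul_sum]
  refine Finset.sum_congr rfl fun i hi => ?_
  obtain ⟨r, rfl⟩ := Nat.exists_eq_add_of_le (Finset.mem_range_succ_iff.mp hi)
  simp only [map_mul, map_pow, eval_C, Nat.add_sub_cancel_left, div_pow, pow_add]
  field_simp

theorem alpha1_mul_gamma2 (n : ℕ) (hn : 3 ≤ n) :
    alpha1 n hn * gamma2 n hn = beta2 n hn * beta3 n hn * (beta2 n hn - beta3 n hn) := by
  simp only [alpha1, gamma2, beta2, beta3, del]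
  ring

theorem UInv.mem_generated_of_hasDegrees {n : ℕ} {hn : 3 ≤ n} {m D k : ℕ} {f : P n}
    (hf : UInv n f) (hd : HasDegrees n hn m D k f) : f ∈ generated n hn := by
  have hA : ∀ a ∈ ({alpha1 n hn, beta2 n hn, beta3 n hn, gamma1 n hn, gamma2 n hn} : Set (P n)),
      a ∈ generated n hn := fun a ha => Algebra.subset_adjoin ha
  have hne : alpha1 n hn * beta3 n hn * gamma1 n hn ≠ 0 := fun h => by
    obtain ⟨h1, h2, h3, h4⟩ := eval_generators_padRows (n := n) (hn := hn)
      ![![1, 1, 1], ![0, 1, 0], ![0, 0, 1]]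
    have := congrArg (eval (padRows n ![![1, 1, 1], ![0, 1, 0], ![0, 0, 1]])) h
    rw [map_mul, map_mul, h1, h3, h4] at this
    simp at this
  suffices h : ∃ F ∈ generated n hn, ∀ x, eval x (alpha1 n hn) ≠ 0 → eval x (beta3 n hn) ≠ 0 →
      eval x (gamma1 n hn) ≠ 0 → eval x f = eval x F by
    obtain ⟨F, hF, hfF⟩ := h
    suffices f = F by rwa [this]
    refine mul_left_cancel₀ hne (MvPolynomial.funext fun x => ?_)
    simp only [map_mul]
    by_cases h1 : eval x (alpha1 n hn) = 0
    · simp [h1]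
    by_cases h2 : eval x (beta3 n hn) = 0
    · simp [h2]
    by_cases h3 : eval x (gamma1 n hn) = 0
    · simp [h3]
    rw [hfF x h1 h2 h3]
  by_cases hp : slice n f = 0
  · refine ⟨0, zero_mem _, fun x h1 h2 h3 => ?_⟩
    rw [hf.eval_eq_slice hd x h1 h2 h3, hp]
    simp
  have hdeg1 := hf.natDegree_slice_add_le_columns hd hp
  have hdeg2 := hf.natDegree_slice_add_le_rows hd hp
  obtain ⟨q, hq⟩ := hf.exists_slice_eq hd
  have hq0 : q ≠ 0 := by
    rintro rfl
    exact hp (by simp [hq])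
  have hlin : (Polynomial.X * (Polynomial.X - 1) : Polynomial ℂ).Monic :=
    Polynomial.monic_X.mul (by simpa using Polynomial.monic_X_sub_C (1 : ℂ))
  have hlin2 : (Polynomial.X * (Polynomial.X - 1) : Polynomial ℂ).natDegree = 2 := by
    rw [Polynomial.monic_X.natDegree_mul (by simpa using Polynomial.monic_X_sub_C (1 : ℂ))]
    rw [← Polynomial.C_1, Polynomial.natDegree_X, Polynomial.natDegree_X_sub_C]
  have hqdeg : (slice n f).natDegree = (D - m) * 2 + q.natDegree := by
    rw [hq, (hlin.pow _).natDegree_mul' hq0, hlin.natDegree_pow, hlin2]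
  generalize he : D - m = e at *
  generalize he' : m - D = e' at *
  obtain ⟨N, hN⟩ : ∃ N, D = N + k + 3 * e := ⟨D - k - 3 * e, by omega⟩
  refine ⟨alpha1 n hn ^ e' * gamma2 n hn ^ e * gamma1 n hn ^ k * betaForm n hn q N,
    mul_mem (mul_mem (mul_mem (pow_mem (hA _ (by simp)) _) (pow_mem (hA _ (by simp)) _))
      (pow_mem (hA _ (by simp)) _)) (betaForm_mem n hn q N), fun x h1 h2 h3 => ?_⟩
  rw [hf.eval_eq_slice hd x h1 h2 h3, hq]
  simp only [map_mul, map_pow]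
  rw [eval_betaForm n hn q N (by omega) x h2]
  have hrel := congrArg (eval x) (alpha1_mul_gamma2 n hn)
  simp only [map_mul, map_sub] at hrel
  simp only [Polynomial.eval_mul, Polynomial.eval_pow, Polynomial.eval_X, Polynomial.eval_sub,
    Polynomial.eval_one]
  generalize eval x (alpha1 n hn) = a at *
  generalize eval x (beta2 n hn) = b at *
  generalize eval x (beta3 n hn) = c at *
  generalize eval x (gamma1 n hn) = g at *
  generalize eval x (gamma2 n hn) = g' at *
  have hrel' : b / c * (b / c - 1) = a * g' / c ^ 3 := by
    rw [hrel]
    field_simp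
  rw [hrel']
  have hm : m + e = D + e' := by omega
  have ham : a ^ m * a ^ e = a ^ D * a ^ e' := by rw [← pow_add, hm, pow_add]
  generalize Polynomial.eval (b / c) q = z
  rw [div_pow, div_pow, div_pow, mul_pow]
  have hc : c ^ D = c ^ N * c ^ k * (c ^ 3) ^ e := by rw [hN, pow_add, pow_add, pow_mul]
  rw [hc]
  field_simp
  linear_combination g' ^ e * z * ham

theorem UInv.mem_generated {n : ℕ} {hn : 3 ≤ n} {f : P n} (hf : UInv n f) (hQ : InQ n f) :
    f ∈ generated n hn := by
  have hcomp : ∀ (u : Fin n → ℕ) (v : Fin 3 → ℕ) (h : P n) (c : ℕ), UInv n h →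
      UInv n (weightedHomogeneousComponent (fun p : Fin n × Fin 3 => u p.1 + v p.2) c h) :=
    fun u v h c hh => weightedHomogeneousComponent_mem _
      (Subalgebra.toSubmodule (invariants n)) (fun t ht g hg => uInv_scale n u v t ht g hg) h hh c
  have hrow : ∀ (i₀ : Fin n) (d : Fin n × Fin 3 →₀ ℕ), Finsupp.weight
      (fun p : Fin n × Fin 3 => (if p.1 = i₀ then 1 else 0) + 0) d = ∑ j, d (i₀, j) := by
    intro i₀ d
    rw [Finsupp.weight_apply, Finsupp.sum_fintype _ _ (by simp), Fintype.sum_prod_type_right]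
    simp
  have hcol : ∀ d : Fin n × Fin 3 →₀ ℕ, Finsupp.weight
      (fun p : Fin n × Fin 3 => 0 + if p.2 = 0 then 1 else 0) d = ∑ i, d (i, 0) := by
    intro d
    rw [Finsupp.weight_apply, Finsupp.sum_fintype _ _ (by simp), Fintype.sum_prod_type]
    simp
  obtain ⟨s₁, hs₁⟩ := exists_sum_weightedHomogeneousComponent
    (fun p : Fin n × Fin 3 => 0 + if p.2 = 0 then 1 else 0) f
  rw [← hs₁]
  refine sum_mem fun m _ => ?_
  have hm := hcomp (fun _ => 0) (fun j => if j = 0 then 1 else 0) f m hf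
  have hmQ := support_weightedHomogeneousComponent_subset
    (fun p : Fin n × Fin 3 => 0 + if p.2 = 0 then 1 else 0) m f
  have hmw := weight_eq_of_mem_support
    (fun p : Fin n × Fin 3 => 0 + if p.2 = 0 then 1 else 0) m f
  generalize weightedHomogeneousComponent
    (fun p : Fin n × Fin 3 => 0 + if p.2 = 0 then 1 else 0) m f = f₁ at hm hmQ hmw ⊢
  obtain ⟨s₂, hs₂⟩ := exists_sum_weightedHomogeneousComponent
    (fun p : Fin n × Fin 3 => (if p.1 = Fin.castLE hn 1 then 1 else 0) + 0) f₁
  rw [← hs₂]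
  refine sum_mem fun D _ => ?_
  have hD := hcomp (fun i => if i = Fin.castLE hn 1 then 1 else 0) (fun _ => 0) f₁ D hm
  have hDQ := support_weightedHomogeneousComponent_subset
    (fun p : Fin n × Fin 3 => (if p.1 = Fin.castLE hn 1 then 1 else 0) + 0) D f₁
  have hDw := weight_eq_of_mem_support
    (fun p : Fin n × Fin 3 => (if p.1 = Fin.castLE hn 1 then 1 else 0) + 0) D f₁
  generalize weightedHomogeneousComponent
    (fun p : Fin n × Fin 3 => (if p.1 = Fin.castLE hn 1 then 1 else 0) + 0) D f₁ = f₂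
    at hD hDQ hDw ⊢
  obtain ⟨s₃, hs₃⟩ := exists_sum_weightedHomogeneousComponent
    (fun p : Fin n × Fin 3 => (if p.1 = Fin.castLE hn 2 then 1 else 0) + 0) f₂
  rw [← hs₃]
  refine sum_mem fun k _ => ?_
  refine (hcomp (fun i => if i = Fin.castLE hn 2 then 1 else 0) (fun _ => 0) f₂ k
    hD).mem_generated_of_hasDegrees (m := m) (D := D) (k := k) fun d hd => ?_
  have hd₂ := support_weightedHomogeneousComponent_subset _ _ _ hd
  refine ⟨fun j => ?_, ?_, ?_⟩
  · rw [hQ d (hmQ (hDQ hd₂)) j, ← hcol, hmw d (hDQ hd₂)]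
  · rw [← hrow, hDw d hd₂]
  · rw [← hrow, weight_eq_of_mem_support _ _ _ _ hd]

/-! ### The generators are invariants of the right degree -/

/-- The algebra `Q`. -/
def balanced (n : ℕ) : Subalgebra ℂ (P n) where
  carrier := {f | InQ n f}
  mul_mem' {f g} hf hg d hd j := by
    classical
    obtain ⟨a, ha, b, hb, rfl⟩ := Finset.mem_add.mp (support_mul f g hd)
    simp only [Finsupp.add_apply, Finset.sum_add_distrib]
    rw [hf a ha j, hg b hb j]
  add_mem' {f g} hf hg d hd j := by
    classical
    rcases Finset.mem_union.mp (support_add hd) with h | h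
    · exact hf d h j
    · exact hg d h j
  algebraMap_mem' c d hd j := by
    classical
    rw [algebraMap_eq, mem_support_iff, coeff_C] at hd
    obtain rfl : 0 = d := by
      by_contra h
      simp [h] at hd
    simp

/-- The column multidegree. -/
def colWeight (n : ℕ) (p : Fin n × Fin 3) : Fin 3 → ℕ := Pi.single p.2 1

theorem inQ_of_isWeightedHomogeneous (n : ℕ) (f : P n) (m : ℕ) (c : Fin 3 → ℕ)
    (hf : IsWeightedHomogeneous (colWeight n) f c) (hc : c = fun _ => m) : InQ n f := by
  intro d hd j
  have hw : ∀ j, ∑ i, d (i, j) = m := fun j => by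
    have h := congrFun (hf (mem_support_iff.mp hd)) j
    rw [Finsupp.weight_apply, Finsupp.sum_fintype _ _ (by simp), Fintype.sum_prod_type, hc] at h
    simpa [colWeight, Finset.sum_apply, Pi.single_apply] using h
  rw [hw, hw]

theorem isWeightedHomogeneous_Xe (n : ℕ) (hn : 3 ≤ n) (i j : Fin 3) :
    IsWeightedHomogeneous (colWeight n) (Xe n hn i j) (Pi.single j 1) :=
  isWeightedHomogeneous_X ℂ (colWeight n) (Fin.castLE hn i, j)

theorem isWeightedHomogeneous_del (n : ℕ) (hn : 3 ≤ n) (i j : Fin 3) :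
    IsWeightedHomogeneous (colWeight n) (del n hn i j) (Pi.single i 1 + Pi.single j 1) := by
  have h := isWeightedHomogeneous_Xe n hn
  exact Submodule.sub_mem (weightedHomogeneousSubmodule ℂ (colWeight n) _)
    ((h 0 i).mul (h 1 j)) ((h 1 i).mul (h 0 j))

theorem generated_le_balanced (n : ℕ) (hn : 3 ≤ n) : generated n hn ≤ balanced n := by
  have h := isWeightedHomogeneous_Xe n hn
  have hd := isWeightedHomogeneous_del n hn
  refine Algebra.adjoin_le ?_
  rintro f (rfl | rfl | rfl | rfl | rfl)
  · refine inQ_of_isWeightedHomogeneous n _ 1 _ (((h 0 0).mul (h 0 1)).mul (h 0 2)) ?_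
    decide
  · refine inQ_of_isWeightedHomogeneous n _ 1 _ ((h 0 1).mul (hd 0 2)) ?_
    decide
  · refine inQ_of_isWeightedHomogeneous n _ 1 _ ((h 0 2).mul (hd 0 1)) ?_
    decide
  · have hdet : gamma1 n hn = Xe n hn 2 0 * del n hn 1 2 - Xe n hn 2 1 * del n hn 0 2 +
        Xe n hn 2 2 * del n hn 0 1 := by
      rw [gamma1, Matrix.det_fin_three]
      simp only [Matrix.of_apply, del]
      ring
    rw [hdet]
    refine add_mem (sub_mem ?_ ?_) ?_
    · refine inQ_of_isWeightedHomogeneous n _ 1 _ ((h 2 0).mul (hd 1 2)) ?_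
      decide
    · refine inQ_of_isWeightedHomogeneous n _ 1 _ ((h 2 1).mul (hd 0 2)) ?_
      decide
    · refine inQ_of_isWeightedHomogeneous n _ 1 _ ((h 2 2).mul (hd 0 1)) ?_
      decide
  · refine inQ_of_isWeightedHomogeneous n _ 2 _ (((hd 0 1).mul (hd 0 2)).mul (hd 1 2)) ?_
    decide

theorem matAct_Xe (n : ℕ) (hn : 3 ≤ n) (g : Matrix (Fin n) (Fin n) ℂ) (hg : IsUpperUni n g)
    (i j : Fin 3) : matAct n g (Xe n hn i j) =
      ∑ k : Fin 3, C (g (Fin.castLE hn k) (Fin.castLE hn i)) * Xe n hn k j := by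
  rw [matAct, Xe, aeval_X]
  simp only [Xe]
  have hinj : Function.Injective (Fin.castLE hn) := Fin.castLE_injective hn
  rw [← Finset.sum_image (s := Finset.univ) (g := Fin.castLE hn)
    (f := fun s => C (g s (Fin.castLE hn i)) * (X (s, j) : P n)) hinj.injOn]
  symm
  refine Finset.sum_subset (Finset.subset_univ _) fun s _ hs => ?_
  have hlt : Fin.castLE hn i < s := by
    by_contra! hle
    refine hs (Finset.mem_image.mpr ⟨⟨s.val, ?_⟩, Finset.mem_univ _, rfl⟩)
    exact lt_of_le_of_lt hle i.isLt
  rw [hg.2 s _ hlt, C_0, zero_mul]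

theorem generated_le_invariants (n : ℕ) (hn : 3 ≤ n) : generated n hn ≤ invariants n := by
  have key : ∀ f ∈ ({alpha1 n hn, beta2 n hn, beta3 n hn, gamma1 n hn, gamma2 n hn} : Set (P n)),
      UInv n f := by
    intro f hf g hg
    have h0 : ∀ j, matAct n g (Xe n hn 0 j) = Xe n hn 0 j := fun j => by
      rw [matAct_Xe n hn g hg, Fin.sum_univ_three, hg.1,
        hg.2 (Fin.castLE hn 1) (Fin.castLE hn 0) (by simp),
        hg.2 (Fin.castLE hn 2) (Fin.castLE hn 0) (by simp)]
      simp
    have h1 : ∀ j, matAct n g (Xe n hn 1 j) =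
        C (g (Fin.castLE hn 0) (Fin.castLE hn 1)) * Xe n hn 0 j + Xe n hn 1 j := fun j => by
      rw [matAct_Xe n hn g hg, Fin.sum_univ_three, hg.1,
        hg.2 (Fin.castLE hn 2) (Fin.castLE hn 1) (by simp)]
      simp
    have h2 : ∀ j, matAct n g (Xe n hn 2 j) =
        C (g (Fin.castLE hn 0) (Fin.castLE hn 2)) * Xe n hn 0 j +
        C (g (Fin.castLE hn 1) (Fin.castLE hn 2)) * Xe n hn 1 j + Xe n hn 2 j := fun j => by
      rw [matAct_Xe n hn g hg, Fin.sum_univ_three, hg.1]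
      simp
    rcases hf with rfl | rfl | rfl | rfl | rfl <;>
    simp only [alpha1, beta2, beta3, gamma1, gamma2, del, Matrix.det_fin_three, Matrix.of_apply,
      map_mul, map_sub, map_add, h0, h1, h2] <;>
    ring
  exact Algebra.adjoin_le key

/-- The algebra `Q^{U_n}` of `U_n`-invariants in `Q` is `ℂ[α₁, β₂, β₃, γ₁, γ₂]`. -/
theorem stmt_6 (n : ℕ) (hn : 3 ≤ n) :
    {f : P n | InQ n f ∧ UInv n f} =
      (Algebra.adjoin ℂ
        {alpha1 n hn, beta2 n hn, beta3 n hn, gamma1 n hn, gamma2 n hn} : Set (P n)) := by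
  refine Set.Subset.antisymm (fun f hf => hf.2.mem_generated hf.1) fun f hf => ?_
  exact ⟨generated_le_balanced n hn hf, generated_le_invariants n hn hf⟩
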